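/- Let F ∈ ℤ[t] be an irreducible polynomial of degree g ≥ 2. There exist constants D ≥ 2 and K > 0, depending only on F, such that for every real η > 0 and all reals X, z with 100 ≤ X ≤ z: ∑_{ℓ} L(ℓ; η) ρ(ℓ)/(φ_F(ℓ) · (log h(ℓ; X))²) ≤ (K/(log X)²) · (log z/log X)^{4g} · ∑_{a ∈ 𝒫(D, z)} L(a; η) ρ(a)/φ_F(a), where the left-hand sum runs over all positive integers ℓ > √X (not necessarily squarefree) with P⁻(ℓ) > D and P⁺(ℓ) ≤ z. -/

import Mathlib

open Real MeasureTheory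
open scoped Classical

/-- number of residues n mod d with F(n) ≡ 0 (mod d) -/
noncomputable def polyRho (F : Polynomial ℤ) (d : ℕ) : ℕ :=
  ((Finset.range d).filter (fun n => (d : ℤ) ∣ F.eval (n : ℤ))).card

/-- H_F(x,y,z): number of positive n ≤ x with F(n) having a divisor in (y,z] -/
noncomputable def polyH (F : Polynomial ℤ) (x y z : ℝ) : ℕ :=
  {n : ℕ | 0 < n ∧ (n : ℝ) ≤ x ∧
    ∃ d : ℕ, 0 < d ∧ (d : ℤ) ∣ F.eval (n : ℤ) ∧ y < (d : ℝ) ∧ (d : ℝ) ≤ z}.ncard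

/-- H(x,y,z): number of positive n ≤ x having a divisor in (y,z] -/
noncomputable def Hdiv (x y z : ℝ) : ℕ :=
  {n : ℕ | 0 < n ∧ (n : ℝ) ≤ x ∧
    ∃ d : ℕ, 0 < d ∧ d ∣ n ∧ y < (d : ℝ) ∧ (d : ℝ) ≤ z}.ncard

/-- L(a;σ) -/
noncomputable def Lfun (a : ℕ) (σ : ℝ) : ℝ :=
  (volume {x : ℝ | ∃ d : ℕ, d ∣ a ∧ Real.exp x < (d : ℝ) ∧ (d : ℝ) ≤ Real.exp (x + σ)}).toReal

/-- W(a;σ): ordered pairs of divisors near each other -/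
noncomputable def Wfun (a : ℕ) (σ : ℝ) : ℕ :=
  {p : ℕ × ℕ | p.1 ∣ a ∧ p.2 ∣ a ∧ |Real.log ((p.1 : ℝ) / (p.2 : ℝ))| ≤ σ}.ncard

/-- 𝒫(s,t): squarefree integers with all prime factors in (s,t] -/
def Psf (s t : ℝ) : Set ℕ :=
  {a : ℕ | 0 < a ∧ Squarefree a ∧ ∀ p : ℕ, p.Prime → p ∣ a → s < (p : ℝ) ∧ (p : ℝ) ≤ t}

/-- φ_F(n) = n ∏_{p|n} (1 - ρ(p)/p) -/
noncomputable def polyPhi (F : Polynomial ℤ) (n : ℕ) : ℝ :=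
  (n : ℝ) * ∏ p ∈ n.primeFactors, (1 - (polyRho F p : ℝ) / p)

/-- P⁺(n): largest prime factor, P⁺(1)=0 -/
def Pplus (n : ℕ) : ℕ := n.primeFactors.sup id

/-- h(n;X): least prime q with ∏_{p^ν ∥ n, p ≤ q} p^ν > √X -/
noncomputable def hfun (n : ℕ) (X : ℝ) : ℕ :=
  sInf {q : ℕ | q.Prime ∧
    Real.sqrt X < ∏ p ∈ n.primeFactors.filter (fun p => p ≤ q), (p : ℝ) ^ (n.factorization p)}

lemma prime_pow_dvd_factorial_mul {p : ℕ} (hp : 0 < p) (k : ℕ) : p ^ k ∣ (p * k).factorial := by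
  induction k with
  | zero => simp
  | succ k ih =>
    obtain ⟨m, hm⟩ : ∃ m, p * (k + 1) = m + 1 := ⟨p * (k + 1) - 1, by
      have : 0 < p * (k + 1) := by positivity
      omega⟩
    rw [hm, Nat.factorial_succ, ← hm, pow_succ, mul_comm]
    refine mul_dvd_mul (dvd_mul_right _ _) (ih.trans (Nat.factorial_dvd_factorial ?_))
    have : p * (k + 1) = p * k + p := by ring
    omega

lemma sum_primes_div_mul_log_le (n : ℕ) :
    ∑ p ∈ (Finset.range (n + 1)).filter Nat.Prime, ((n / p : ℕ) : ℝ) * log p ≤ n * log n := by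
  have hdvd : ∏ p ∈ (Finset.range (n + 1)).filter Nat.Prime, p ^ (n / p) ∣ n.factorial := by
    refine Finset.prod_dvd_of_isRelPrime ?_ ?_
    · intro p hp q hq hpq
      simp only [Finset.coe_filter, Set.mem_ofPred_eq] at hp hq
      exact Nat.coprime_iff_isRelPrime.1 (Nat.Coprime.pow _ _ ((Nat.coprime_primes hp.2 hq.2).2 hpq))
    · intro p hp
      simp only [Finset.mem_filter] at hp
      exact (prime_pow_dvd_factorial_mul hp.2.pos _).trans
        (Nat.factorial_dvd_factorial (Nat.mul_div_le n p))
  have hle := (Nat.le_of_dvd (Nat.factorial_pos n) hdvd).trans (Nat.factorial_le_pow n)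
  have hpos : 0 < ∏ p ∈ (Finset.range (n + 1)).filter Nat.Prime, p ^ (n / p) :=
    Finset.prod_pos fun p hp => pow_pos (Finset.mem_filter.1 hp).2.pos _
  have hlog : log ((∏ p ∈ (Finset.range (n + 1)).filter Nat.Prime, p ^ (n / p) : ℕ) : ℝ)
      ≤ log ((n ^ n : ℕ) : ℝ) :=
    log_le_log (by exact_mod_cast hpos) (by exact_mod_cast hle)
  push_cast at hlog
  rw [log_prod, log_pow] at hlog
  · simpa only [log_pow] using hlog
  · intro p hp
    have := (Finset.mem_filter.1 hp).2.pos
    positivity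

/-- An upper bound of Mertens type. -/
lemma sum_primes_log_div_le (n : ℕ) (hn : 2 ≤ n) :
    ∑ p ∈ (Finset.range (n + 1)).filter Nat.Prime, log p / p ≤ 3 * log n := by
  have hn0 : (0 : ℝ) < n := by positivity
  have htheta : ∑ p ∈ (Finset.range (n + 1)).filter Nat.Prime, log p ≤ log 4 * n := by
    have h := Chebyshev.theta_le_log4_mul_x (x := n) (by positivity)
    rw [Chebyshev.theta_eq_sum_Icc, Nat.floor_natCast] at h
    simpa [Finset.range_eq_Ico, Finset.Ico_add_one_right_eq_Icc] using h
  have hfloor : ∑ p ∈ (Finset.range (n + 1)).filter Nat.Prime, ((n : ℝ) / p - 1) * log p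
      ≤ n * log n := by
    refine le_trans (Finset.sum_le_sum fun p hp => ?_) (sum_primes_div_mul_log_le n)
    have hp' := (Finset.mem_filter.1 hp).2
    refine mul_le_mul_of_nonneg_right ?_ (log_natCast_nonneg p)
    have h := Nat.lt_floor_add_one ((n : ℝ) / p)
    rw [Nat.floor_div_natCast, Nat.floor_natCast] at h
    linarith
  have hsum : n * ∑ p ∈ (Finset.range (n + 1)).filter Nat.Prime, log p / p
      = ∑ p ∈ (Finset.range (n + 1)).filter Nat.Prime, ((n : ℝ) / p - 1) * log p
        + ∑ p ∈ (Finset.range (n + 1)).filter Nat.Prime, log p := by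
    rw [Finset.mul_sum, ← Finset.sum_add_distrib]
    refine Finset.sum_congr rfl fun p hp => ?_
    ring
  have h4 : log 4 ≤ 2 * log n := by
    rw [show (4 : ℝ) = 2 ^ 2 by norm_num, log_pow]
    have : log 2 ≤ log n := log_le_log (by norm_num) (by exact_mod_cast hn)
    push_cast
    linarith
  refine le_of_mul_le_mul_left ?_ hn0
  rw [hsum]
  nlinarith

open Polynomial in
lemma exists_prime_bound_eval_derivative (F : ℤ[X]) (hF : Irreducible F) (hdeg : F.natDegree ≠ 0) :
    ∃ R : ℕ, ∀ p : ℕ, p.Prime → R < p → ∀ n : ℤ, (p : ℤ) ∣ F.eval n →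
      ¬ (p : ℤ) ∣ F.derivative.eval n := by
  have hirr : Irreducible (F.map (Int.castRingHom ℚ)) :=
    (IsPrimitive.Int.irreducible_iff_irreducible_map_cast (hF.isPrimitive hdeg)).1 hF
  have hcop : IsCoprime (F.map (Int.castRingHom ℚ)) (F.derivative.map (Int.castRingHom ℚ)) := by
    have := hirr.separable
    rwa [Polynomial.Separable, derivative_map] at this
  have hres : resultant F F.derivative ≠ 0 := by
    have h := mt resultant_eq_zero_iff.1 (fun h => h.2 hcop)
    rw [natDegree_map_eq_of_injective Int.cast_injective,
      natDegree_map_eq_of_injective Int.cast_injective, resultant_map_map] at h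
    exact fun h0 => h (by rw [h0, map_zero])
  obtain ⟨a, b, -, -, hab⟩ := exists_mul_add_mul_eq_C_resultant F F.derivative le_rfl le_rfl
    (Or.inl hdeg)
  refine ⟨(resultant F F.derivative).natAbs, fun p hp hlt n h1 h2 => ?_⟩
  have hev := congrArg (eval n) hab
  simp only [eval_add, eval_mul, eval_C] at hev
  have hdvd : (p : ℤ) ∣ resultant F F.derivative :=
    hev ▸ dvd_add (h1.mul_right _) (h2.mul_right _)
  exact absurd (Nat.le_of_dvd (Int.natAbs_pos.2 hres) (Int.natCast_dvd.1 hdvd)) (by omega)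

lemma polyRho_eq_card_filter (F : Polynomial ℤ) (d : ℕ) :
    polyRho F d = ((Finset.range d).filter (fun n : ℕ => (d : ℤ) ∣ F.eval (n : ℤ))).card := by
  symm
  refine Finset.card_bij (fun n _ => (n : ℤ)) ?_ ?_ ?_
  · intro n hn
    simpa using hn
  · intro a _ b _ hab
    exact_mod_cast hab
  · intro x hx
    simp only [Finset.mem_filter, Finset.bind_def, Finset.pure_def, Finset.mem_sup,
      Finset.mem_singleton] at hx
    obtain ⟨⟨n, hn, rfl⟩, hdvd⟩ := hx
    exact ⟨n, Finset.mem_filter.2 ⟨hn, hdvd⟩, rfl⟩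

open Polynomial in
lemma polyRho_le_natDegree (F : ℤ[X]) (p : ℕ) (hp : p.Prime)
    (hlead : F.leadingCoeff.natAbs < p) (hF : F ≠ 0) : polyRho F p ≤ F.natDegree := by
  have := Fact.mk hp
  have h0 : F.map (Int.castRingHom (ZMod p)) ≠ 0 := by
    intro h
    have hc := congrArg (fun G => coeff G F.natDegree) h
    simp only [coeff_map, coeff_zero, eq_intCast, coeff_natDegree] at hc
    rw [ZMod.intCast_zmod_eq_zero_iff_dvd, Int.natCast_dvd] at hc
    exact absurd (Nat.le_of_dvd (Int.natAbs_pos.2 (leadingCoeff_ne_zero.2 hF)) hc) (by omega)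
  rw [polyRho_eq_card_filter]
  calc _ ≤ (F.map (Int.castRingHom (ZMod p))).roots.toFinset.card := by
        refine Finset.card_le_card_of_injOn (fun n => (n : ZMod p)) ?_ ?_
        · intro n hn
          simp only [Finset.coe_filter, Finset.mem_range, Set.mem_ofPred_eq] at hn
          simp only [Finset.mem_coe, Multiset.mem_toFinset, mem_roots h0, IsRoot.def]
          rw [show (n : ZMod p) = Int.castRingHom (ZMod p) (n : ℤ) by simp, eval_map_apply]
          exact (ZMod.intCast_zmod_eq_zero_iff_dvd _ _).2 hn.2
        · intro a ha b hb hab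
          simp only [Finset.coe_filter, Finset.mem_range, Set.mem_ofPred_eq] at ha hb
          have := (ZMod.natCast_eq_natCast_iff' a b p).1 hab
          rwa [Nat.mod_eq_of_lt ha.1, Nat.mod_eq_of_lt hb.1] at this
    _ ≤ (F.map (Int.castRingHom (ZMod p))).natDegree :=
        (Multiset.toFinset_card_le _).trans (card_roots' _)
    _ ≤ F.natDegree := natDegree_map_le

open Polynomial in
lemma polyRho_prime_pow_le (F : ℤ[X]) (p : ℕ) (hp : p.Prime)
    (hsep : ∀ n : ℤ, (p : ℤ) ∣ F.eval n → ¬ (p : ℤ) ∣ F.derivative.eval n) (ν : ℕ) (hν : ν ≠ 0) :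
    polyRho F (p ^ ν) ≤ polyRho F p := by
  have hmod (n : ℕ) : (p : ℤ) ∣ F.eval (n : ℤ) ↔ (p : ℤ) ∣ F.eval ((n % p : ℕ) : ℤ) := by
    have h1 : (p : ℤ) ∣ (n : ℤ) - ((n % p : ℕ) : ℤ) := by
      push_cast
      exact Int.dvd_self_sub_emod
    exact dvd_iff_dvd_of_dvd_sub (h1.trans (sub_dvd_eval_sub _ _ F))
  rw [polyRho_eq_card_filter, polyRho_eq_card_filter]
  refine Finset.card_le_card_of_injOn (fun n => n % p) ?_ ?_
  · intro n hn
    simp only [Finset.coe_filter, Finset.mem_range, Set.mem_ofPred_eq] at hn ⊢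
    exact ⟨Nat.mod_lt _ hp.pos, (hmod n).1
      ((show (p : ℤ) ∣ ((p ^ ν : ℕ) : ℤ) by exact_mod_cast dvd_pow_self p hν).trans hn.2)⟩
  · intro a ha b hb hab
    simp only [Finset.coe_filter, Finset.mem_range, Set.mem_ofPred_eq] at ha hb
    obtain ⟨k, hk⟩ := binomExpansion F (a : ℤ) ((b : ℤ) - a)
    rw [add_sub_cancel] at hk
    have hpa : (p : ℤ) ∣ F.eval (a : ℤ) :=
      (show (p : ℤ) ∣ ((p ^ ν : ℕ) : ℤ) by exact_mod_cast dvd_pow_self p hν).trans ha.2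
    have hpd : (p : ℤ) ∣ (b : ℤ) - a := (Nat.modEq_iff_dvd).1 hab
    have hdvd : ((p ^ ν : ℕ) : ℤ) ∣ (F.derivative.eval (a : ℤ) + k * (b - a)) * ((b : ℤ) - a) := by
      have := dvd_sub hb.2 ha.2
      rw [hk] at this
      rwa [show (F.derivative.eval (a : ℤ) + k * (b - a)) * ((b : ℤ) - a)
        = F.eval (a : ℤ) + F.derivative.eval (a : ℤ) * (b - a) + k * (b - a) ^ 2 - F.eval (a : ℤ)
        by ring]
    have hcop : IsCoprime ((p ^ ν : ℕ) : ℤ) (F.derivative.eval (a : ℤ) + k * (b - a)) := by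
      push_cast
      refine IsCoprime.pow_left ?_
      rw [(Nat.prime_iff_prime_int.1 hp).coprime_iff_not_dvd]
      intro h
      exact hsep _ hpa ((dvd_add_left (hpd.mul_left k)).1 h)
    have hfin := (Nat.modEq_iff_dvd).2 (hcop.dvd_of_dvd_mul_left hdvd)
    rw [Nat.ModEq, Nat.mod_eq_of_lt ha.1, Nat.mod_eq_of_lt hb.1] at hfin
    exact hfin

open Polynomial in
lemma polyRho_eq_card (F : ℤ[X]) (d : ℕ) [NeZero d] :
    polyRho F d = Fintype.card {x : ZMod d // aeval x F = 0} := by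
  rw [Fintype.card_subtype, polyRho_eq_card_filter]
  have hev (n : ℕ) : aeval (n : ZMod d) F = ((F.eval (n : ℤ) : ℤ) : ZMod d) := by
    have := aeval_algebraMap_apply (ZMod d) (n : ℤ) F
    simpa using this
  refine Finset.card_bij (fun n _ => (n : ZMod d)) ?_ ?_ ?_
  · intro n hn
    simp only [Finset.mem_filter, Finset.mem_range, Finset.mem_univ, true_and] at hn ⊢
    rw [hev]
    exact (ZMod.intCast_zmod_eq_zero_iff_dvd _ _).2 hn.2
  · intro a ha b hb hab
    simp only [Finset.mem_filter, Finset.mem_range] at ha hb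
    have := (ZMod.natCast_eq_natCast_iff' a b d).1 hab
    rwa [Nat.mod_eq_of_lt ha.1, Nat.mod_eq_of_lt hb.1] at this
  · intro x hx
    simp only [Finset.mem_filter, Finset.mem_univ, true_and] at hx
    refine ⟨x.val, ?_, ZMod.natCast_zmod_val x⟩
    simp only [Finset.mem_filter, Finset.mem_range]
    refine ⟨ZMod.val_lt x, (ZMod.intCast_zmod_eq_zero_iff_dvd _ _).1 ?_⟩
    rw [← hev, ZMod.natCast_zmod_val, hx]

open Polynomial in
lemma polyRho_mul (F : ℤ[X]) {a b : ℕ} (ha : a ≠ 0) (hb : b ≠ 0) (hab : a.Coprime b) :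
    polyRho F (a * b) = polyRho F a * polyRho F b := by
  have := NeZero.mk ha
  have := NeZero.mk hb
  rw [polyRho_eq_card, polyRho_eq_card, polyRho_eq_card, ← Fintype.card_prod]
  let e := ZMod.chineseRemainder hab
  have hiff (x : ZMod (a * b)) : aeval x F = 0 ↔ aeval (e x).1 F = 0 ∧ aeval (e x).2 F = 0 := by
    have h1 : e (aeval x F) = aeval (e x) F := (aeval_algHom_apply e.toRingHom.toIntAlgHom x F).symm
    have h2 : (aeval (e x) F).1 = aeval (e x).1 F :=
      (aeval_algHom_apply (RingHom.fst (ZMod a) (ZMod b)).toIntAlgHom (e x) F).symm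
    have h3 : (aeval (e x) F).2 = aeval (e x).2 F :=
      (aeval_algHom_apply (RingHom.snd (ZMod a) (ZMod b)).toIntAlgHom (e x) F).symm
    rw [← map_eq_zero_iff e e.injective, h1, Prod.ext_iff, h2, h3]
    rfl
  refine Fintype.card_congr ((e.toEquiv.subtypeEquiv (q := fun y => aeval y.1 F = 0 ∧
    aeval y.2 F = 0) hiff).trans (Equiv.subtypeProdEquivProd (p := fun y => aeval y F = 0)
    (q := fun y => aeval y F = 0)))

lemma Lfun_nonneg (a : ℕ) (σ : ℝ) : 0 ≤ Lfun a σ := ENNReal.toReal_nonneg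

lemma volume_Lset_ne_top {a : ℕ} (ha : a ≠ 0) (σ : ℝ) :
    volume {x : ℝ | ∃ d : ℕ, d ∣ a ∧ Real.exp x < (d : ℝ) ∧ (d : ℝ) ≤ Real.exp (x + σ)} ≠ ⊤ := by
  refine measure_ne_top_of_subset (?_ : _ ⊆ Set.Icc (-σ) (log a)) measure_Icc_lt_top.ne
  rintro x ⟨d, hda, h1, h2⟩
  have hd : (1 : ℝ) ≤ d := by exact_mod_cast Nat.pos_of_dvd_of_pos hda (Nat.pos_of_ne_zero ha)
  have hda' : (d : ℝ) ≤ a := by exact_mod_cast Nat.le_of_dvd (Nat.pos_of_ne_zero ha) hda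
  constructor
  · have : 0 ≤ x + σ := by
      by_contra! h
      have h1 := Real.exp_lt_exp.2 h
      rw [Real.exp_zero] at h1
      linarith
    linarith
  · rw [le_log_iff_exp_le (by linarith)]
    linarith

lemma Lfun_prime_pow_mul_le {p : ℕ} (hp : p.Prime) (ν : ℕ) {k : ℕ} (hk : k ≠ 0) (σ : ℝ) :
    Lfun (p ^ ν * k) σ ≤ (ν + 1) * Lfun k σ := by
  set S : ℕ → Set ℝ := fun a =>
    {x : ℝ | ∃ d : ℕ, d ∣ a ∧ Real.exp x < (d : ℝ) ∧ (d : ℝ) ≤ Real.exp (x + σ)} with hS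
  have hp0 : (0 : ℝ) < p := by exact_mod_cast hp.pos
  have hsub : S (p ^ ν * k) ⊆ ⋃ i ∈ Finset.range (ν + 1), (fun x => x - i * log p) ⁻¹' S k := by
    rintro x ⟨d, hd, h1, h2⟩
    obtain ⟨u, e, hu, he, rfl⟩ := (Nat.dvd_mul).1 hd
    obtain ⟨i, hi, rfl⟩ := (Nat.dvd_prime_pow hp).1 hu
    have hpi : (0 : ℝ) < (p : ℝ) ^ i := by positivity
    simp only [Set.mem_iUnion, Finset.mem_range]
    refine ⟨i, by omega, e, he, ?_, ?_⟩
    · rw [Real.exp_sub, Real.exp_nat_mul, exp_log hp0, div_lt_iff₀ hpi]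
      push_cast at h1
      linarith
    · rw [sub_add_eq_add_sub, Real.exp_sub, Real.exp_nat_mul, exp_log hp0, le_div_iff₀ hpi]
      push_cast at h2
      linarith
  have hmeas (i : ℕ) : volume ((fun x => x - i * log p) ⁻¹' S k) = volume (S k) := by
    simp_rw [sub_eq_add_neg]
    exact measure_preimage_add_right _ _ _
  have hle : volume (S (p ^ ν * k)) ≤ ((ν + 1 : ℕ) : ENNReal) * volume (S k) := by
    refine (measure_mono hsub).trans ((measure_biUnion_finset_le _ _).trans ?_)
    simp [hmeas]
  have := ENNReal.toReal_mono (ENNReal.mul_ne_top (by simp) (volume_Lset_ne_top hk σ)) hle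
  rw [ENNReal.toReal_mul, ENNReal.toReal_natCast] at this
  push_cast at this
  exact this

/-- Sums over integers with all prime factors in `T` are compared to sums over squarefree ones,
one prime at a time. -/
lemma sum_le_prod_mul_sum_powerset (L W ε f : ℕ → ℝ) (P : Finset ℕ) (hP : ∀ p ∈ P, p.Prime)
    (hL : ∀ n, 0 ≤ L n) (hW : ∀ n, (∀ q : ℕ, q.Prime → q ∣ n → q ∈ P) → n ≠ 0 → 0 ≤ W n)
    (hf : ∀ p ∈ P, 0 ≤ f p) (hε : ∀ p ∈ P, 0 ≤ ε p) (hW1 : W 1 = 1)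
    (hmul : ∀ p ∈ P, ∀ ν m : ℕ, m ≠ 0 → ¬ p ∣ m → (∀ q : ℕ, q.Prime → q ∣ m → q ∈ P) →
      W (p ^ ν * m) = W (p ^ ν) * W m)
    (hone : ∀ p ∈ P, ∀ k : ℕ, k ≠ 0 → ∀ N : ℕ,
      ∑ ν ∈ Finset.range N, L (p ^ ν * k) * W (p ^ ν) ≤ (1 + ε p) * (L k + f p * L (p * k)))
    (T : Finset ℕ) (hT : T ⊆ P) (k : ℕ) (hk : k ≠ 0) (s : Finset ℕ)
    (hs : ∀ l ∈ s, l ≠ 0 ∧ ∀ q : ℕ, q.Prime → q ∣ l → q ∈ T) :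
    ∑ l ∈ s, L (l * k) * W l ≤
      (∏ p ∈ T, (1 + ε p)) * ∑ a ∈ T.powerset, (∏ p ∈ a, f p) * L ((∏ p ∈ a, p) * k) := by
  induction T using Finset.induction_on generalizing k s with
  | empty =>
    have hsub : s ⊆ {1} := by
      intro l hl
      rw [Finset.mem_singleton]
      by_contra h1
      obtain ⟨q, hq, hql⟩ := Nat.exists_prime_and_dvd h1
      exact absurd ((hs l hl).2 q hq hql) (Finset.notMem_empty q)
    calc ∑ l ∈ s, L (l * k) * W l ≤ ∑ l ∈ {1}, L (l * k) * W l :=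
          Finset.sum_le_sum_of_subset_of_nonneg hsub fun i hi _ => by
            rw [Finset.mem_singleton.1 hi, hW1]
            simpa using hL k
      _ = _ := by simp [hW1]
  | insert p T hpT ih =>
    have hpP : p ∈ P := hT (Finset.mem_insert_self p T)
    have hp := hP p hpP
    have hTP : T ⊆ P := (Finset.subset_insert p T).trans hT
    set N := s.sup (fun l => l.factorization p) + 1 with hN
    set s' := s.image (fun l => l / p ^ l.factorization p) with hs'def
    have hs' : ∀ m ∈ s', (m ≠ 0 ∧ ∀ q : ℕ, q.Prime → q ∣ m → q ∈ T) ∧ ¬ p ∣ m := by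
      intro m hm
      obtain ⟨l, hl, rfl⟩ := Finset.mem_image.1 hm
      have hnd := Nat.not_dvd_ordCompl hp (hs l hl).1
      refine ⟨⟨(Nat.ordCompl_pos p (hs l hl).1).ne', fun q hq hqm => ?_⟩, hnd⟩
      refine (Finset.mem_insert.1 ((hs l hl).2 q hq
        (hqm.trans (Nat.ordCompl_dvd l p)))).resolve_left ?_
      rintro rfl
      exact hnd hqm
    have hP' : ∀ m ∈ s', ∀ q : ℕ, q.Prime → q ∣ m → q ∈ P :=
      fun m hm q hq hqm => hTP ((hs' m hm).1.2 q hq hqm)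
    have hWm : ∀ m ∈ s', 0 ≤ W m := fun m hm => hW m (hP' m hm) (hs' m hm).1.1
    have hWp : ∀ ν : ℕ, 0 ≤ W (p ^ ν) := fun ν => hW _
      (fun q hq h => by rwa [(Nat.prime_dvd_prime_iff_eq hq hp).1 (hq.dvd_of_dvd_pow h)])
      (pow_ne_zero _ hp.ne_zero)
    let φ : ℕ → ℕ × ℕ := fun l => (l / p ^ l.factorization p, l.factorization p)
    have hφ (l : ℕ) : p ^ (φ l).2 * (φ l).1 = l := Nat.ordProj_mul_ordCompl_eq_self l p
    have hsplit : ∑ l ∈ s, L (l * k) * W l ≤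
        ∑ x ∈ s' ×ˢ Finset.range N, L (p ^ x.2 * x.1 * k) * W (p ^ x.2 * x.1) := by
      calc ∑ l ∈ s, L (l * k) * W l
          = ∑ l ∈ s, L (p ^ (φ l).2 * (φ l).1 * k) * W (p ^ (φ l).2 * (φ l).1) := by
            simp_rw [hφ]
        _ = ∑ x ∈ s.image φ, L (p ^ x.2 * x.1 * k) * W (p ^ x.2 * x.1) := by
            rw [Finset.sum_image]
            intro a _ b _ hab
            rw [← hφ a, ← hφ b, hab]
        _ ≤ _ := by
            refine Finset.sum_le_sum_of_subset_of_nonneg ?_ ?_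
            · intro x hx
              obtain ⟨l, hl, rfl⟩ := Finset.mem_image.1 hx
              exact Finset.mem_product.2 ⟨Finset.mem_image_of_mem _ hl, Finset.mem_range.2
                (Nat.lt_succ_of_le (Finset.le_sup (f := fun l => l.factorization p) hl))⟩
            · intro x hx _
              have hx1 := (Finset.mem_product.1 hx).1
              rw [hmul p hpP _ _ (hs' _ hx1).1.1 (hs' _ hx1).2 (hP' _ hx1)]
              exact mul_nonneg (hL _) (mul_nonneg (hWp _) (hWm _ hx1))
    have hinner : ∑ x ∈ s' ×ˢ Finset.range N, L (p ^ x.2 * x.1 * k) * W (p ^ x.2 * x.1) ≤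
        ∑ m ∈ s', (1 + ε p) * (L (m * k) * W m + f p * (L (m * (p * k)) * W m)) := by
      rw [Finset.sum_product]
      refine Finset.sum_le_sum fun m hm => ?_
      calc ∑ ν ∈ Finset.range N, L (p ^ ν * m * k) * W (p ^ ν * m)
          = (∑ ν ∈ Finset.range N, L (p ^ ν * (m * k)) * W (p ^ ν)) * W m := by
            rw [Finset.sum_mul]
            refine Finset.sum_congr rfl fun ν _ => ?_
            rw [hmul p hpP _ _ (hs' m hm).1.1 (hs' m hm).2 (hP' m hm), mul_assoc (p ^ ν)]
            ring
        _ ≤ (1 + ε p) * (L (m * k) + f p * L (p * (m * k))) * W m :=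
            mul_le_mul_of_nonneg_right
              (hone p hpP _ (mul_ne_zero (hs' m hm).1.1 hk) N) (hWm m hm)
        _ = _ := by
            rw [mul_left_comm p m k]
            ring
    refine hsplit.trans (hinner.trans ?_)
    rw [← Finset.mul_sum, Finset.sum_add_distrib, ← Finset.mul_sum, Finset.prod_insert hpT,
      mul_assoc]
    have h1 := ih hTP k hk s' fun m hm => (hs' m hm).1
    have h2 := ih hTP (p * k) (mul_ne_zero hp.ne_zero hk) s' fun m hm => (hs' m hm).1
    refine mul_le_mul_of_nonneg_left ?_ (by linarith [hε p hpP])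
    rw [Finset.sum_powerset_insert hpT, mul_add]
    refine add_le_add h1 ((mul_le_mul_of_nonneg_left h2 (hf p hpP)).trans_eq ?_)
    rw [mul_left_comm, Finset.mul_sum]
    congr 1
    refine Finset.sum_congr rfl fun a ha => ?_
    have hpa : p ∉ a := fun h => hpT (Finset.mem_powerset.1 ha h)
    rw [Finset.prod_insert hpa, Finset.prod_insert hpa, ← mul_assoc]
    congr 2
    ring

/-- The multiplicative weight `ρ(n)/φ_F(n)`. -/
noncomputable def rhoPhi (F : Polynomial ℤ) (n : ℕ) : ℝ := (polyRho F n : ℝ) / polyPhi F n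

/-- The completely multiplicative function taking the value `u p` at each prime `p`. -/
noncomputable def primeWeight (u : ℕ → ℝ) (n : ℕ) : ℝ := n.factorization.prod fun p v => u p ^ v

lemma primeWeight_one (u : ℕ → ℝ) : primeWeight u 1 = 1 := by simp [primeWeight]

lemma primeWeight_mul (u : ℕ → ℝ) {a b : ℕ} (ha : a ≠ 0) (hb : b ≠ 0) :
    primeWeight u (a * b) = primeWeight u a * primeWeight u b := by
  unfold primeWeight
  rw [Nat.factorization_mul ha hb]
  exact Finsupp.prod_add_index' (by simp) (by simp [pow_add])

lemma primeWeight_prime_pow (u : ℕ → ℝ) {p : ℕ} (hp : p.Prime) (ν : ℕ) :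
    primeWeight u (p ^ ν) = u p ^ ν := by
  unfold primeWeight
  rw [hp.factorization_pow, Finsupp.prod_single_index (by simp)]

lemma primeWeight_nonneg {u : ℕ → ℝ} (hu : ∀ p, 0 ≤ u p) (n : ℕ) : 0 ≤ primeWeight u n := by
  unfold primeWeight Finsupp.prod
  exact Finset.prod_nonneg fun p _ => pow_nonneg (hu p) _

lemma polyRho_one (F : Polynomial ℤ) : polyRho F 1 = 1 := by
  rw [polyRho_eq_card_filter]
  simp

lemma rhoPhi_one (F : Polynomial ℤ) : rhoPhi F 1 = 1 := by
  simp [rhoPhi, polyRho_one, polyPhi]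

lemma rhoPhi_mul (F : Polynomial ℤ) {a b : ℕ} (ha : a ≠ 0) (hb : b ≠ 0) (hab : a.Coprime b) :
    rhoPhi F (a * b) = rhoPhi F a * rhoPhi F b := by
  have hphi : polyPhi F (a * b) = polyPhi F a * polyPhi F b := by
    unfold polyPhi
    rw [hab.primeFactors_mul, Finset.prod_union hab.disjoint_primeFactors]
    push_cast
    ring
  unfold rhoPhi
  rw [polyRho_mul F ha hb hab, hphi]
  push_cast
  rw [mul_div_mul_comm]

lemma rhoPhi_nonneg (F : Polynomial ℤ) {n : ℕ}
    (h : ∀ p : ℕ, p.Prime → p ∣ n → polyRho F p < p) : 0 ≤ rhoPhi F n := by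
  refine div_nonneg (Nat.cast_nonneg _) (mul_nonneg (Nat.cast_nonneg _) ?_)
  refine Finset.prod_nonneg fun p hp => ?_
  have hpp := Nat.prime_of_mem_primeFactors hp
  have hlt := h p hpp (Nat.dvd_of_mem_primeFactors hp)
  have hp0 : (0 : ℝ) < p := by exact_mod_cast hpp.pos
  rw [sub_nonneg, div_le_one hp0]
  exact_mod_cast hlt.le

lemma rhoPhi_prime_pow_le (F : Polynomial ℤ) {p g : ℕ} (hp : p.Prime) (hg : 2 * g ≤ p)
    (hρ : ∀ ν : ℕ, ν ≠ 0 → polyRho F (p ^ ν) ≤ g) (ν : ℕ) (hν : ν ≠ 0) :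
    rhoPhi F (p ^ ν) ≤ 2 * g / (p : ℝ) ^ ν := by
  have hp0 : (0 : ℝ) < p := by exact_mod_cast hp.pos
  have h1 : (polyRho F p : ℝ) / p ≤ 1 / 2 := by
    have h2 : (polyRho F p : ℝ) ≤ g := by
      have := hρ 1 one_ne_zero
      rw [pow_one] at this
      exact_mod_cast this
    have h3 : (2 : ℝ) * g ≤ p := by exact_mod_cast hg
    rw [div_le_iff₀ hp0]
    linarith
  have hρν : (polyRho F (p ^ ν) : ℝ) ≤ g := by exact_mod_cast hρ ν hν
  have hpν : (0 : ℝ) < (p : ℝ) ^ ν := by positivity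
  unfold rhoPhi polyPhi
  rw [Nat.primeFactors_prime_pow hν hp, Finset.prod_singleton]
  push_cast
  rw [div_le_div_iff₀ (mul_pos hpν (by linarith)) hpν]
  have h4 : 1 ≤ 2 * (1 - (polyRho F p : ℝ) / p) := by linarith
  have hg0 : (0 : ℝ) ≤ g := Nat.cast_nonneg g
  have h5 : (polyRho F (p ^ ν) : ℝ) ≤ g * (2 * (1 - (polyRho F p : ℝ) / p)) :=
    hρν.trans (le_mul_of_one_le_right hg0 h4)
  calc (polyRho F (p ^ ν) : ℝ) * (p : ℝ) ^ ν
      ≤ g * (2 * (1 - (polyRho F p : ℝ) / p)) * (p : ℝ) ^ ν :=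
        mul_le_mul_of_nonneg_right h5 hpν.le
    _ = _ := by ring

lemma add_three_le_two_pow (ν : ℕ) : (ν : ℝ) + 3 ≤ 2 ^ (ν + 2) := by
  induction ν with
  | zero => norm_num
  | succ n ih =>
    rw [show n + 1 + 2 = (n + 2) + 1 from rfl, pow_succ]
    push_cast
    have : (0 : ℝ) ≤ n := Nat.cast_nonneg n
    linarith

lemma sum_Lfun_prime_pow_le (F : Polynomial ℤ) (η u : ℝ) {p g : ℕ} (hp : p.Prime)
    (hg : 2 * g ≤ p) (hp12 : 12 ≤ p) (hρ : ∀ ν : ℕ, ν ≠ 0 → polyRho F (p ^ ν) ≤ g)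
    (hu1 : 1 ≤ u) (hu3 : u ≤ 3) (hf : ∀ ν : ℕ, 0 ≤ rhoPhi F (p ^ ν))
    (k : ℕ) (hk : k ≠ 0) (N : ℕ) :
    ∑ ν ∈ Finset.range N, Lfun (p ^ ν * k) η * (rhoPhi F (p ^ ν) * u ^ ν) ≤
      (1 + (4 * g * (u - 1) / p + 144 * g / (p : ℝ) ^ 2)) *
        (Lfun k η + rhoPhi F p * Lfun (p * k) η) := by
  have hp0 : (0 : ℝ) < p := by exact_mod_cast hp.pos
  have hp12' : (12 : ℝ) ≤ p := by exact_mod_cast hp12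
  have hg0 : (0 : ℝ) ≤ g := Nat.cast_nonneg g
  have hLk := Lfun_nonneg k η
  have hfp : rhoPhi F p ≤ 2 * g / p := by
    simpa using rhoPhi_prime_pow_le F hp hg hρ 1 one_ne_zero
  have hfp0 : 0 ≤ rhoPhi F p := by simpa using hf 1
  have hLpk : Lfun (p * k) η ≤ 2 * Lfun k η := by
    have := Lfun_prime_pow_mul_le hp 1 hk η
    norm_num at this
    exact this
  have hnn (ν : ℕ) : 0 ≤ Lfun (p ^ ν * k) η * (rhoPhi F (p ^ ν) * u ^ ν) :=
    mul_nonneg (Lfun_nonneg _ _) (mul_nonneg (hf ν) (by positivity))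
  have htail (ν : ℕ) : Lfun (p ^ (ν + 2) * k) η * (rhoPhi F (p ^ (ν + 2)) * u ^ (ν + 2)) ≤
      72 * g / (p : ℝ) ^ 2 * Lfun k η * (1 / 2) ^ ν := by
    have h1 : Lfun (p ^ (ν + 2) * k) η ≤ 2 ^ (ν + 2) * Lfun k η := by
      refine (Lfun_prime_pow_mul_le hp (ν + 2) hk η).trans (mul_le_mul_of_nonneg_right ?_ hLk)
      refine le_trans (le_of_eq ?_) (add_three_le_two_pow ν)
      push_cast
      ring
    have h2 : rhoPhi F (p ^ (ν + 2)) * u ^ (ν + 2) ≤ 2 * g / (p : ℝ) ^ (ν + 2) * 3 ^ (ν + 2) :=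
      mul_le_mul (rhoPhi_prime_pow_le F hp hg hρ _ (by omega))
        (pow_le_pow_left₀ (by linarith) hu3 _) (by positivity) (by positivity)
    have h3 : (6 / (p : ℝ)) ^ ν ≤ (1 / 2) ^ ν := by
      refine pow_le_pow_left₀ (by positivity) ?_ _
      rw [div_le_iff₀ hp0]
      linarith
    calc _ ≤ 2 ^ (ν + 2) * Lfun k η * (2 * g / (p : ℝ) ^ (ν + 2) * 3 ^ (ν + 2)) :=
          mul_le_mul h1 h2 (mul_nonneg (hf _) (by positivity)) (by positivity)
      _ = 72 * g / (p : ℝ) ^ 2 * Lfun k η * (6 / (p : ℝ)) ^ ν := by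
          rw [show (6 / (p : ℝ)) ^ ν = 2 ^ ν * 3 ^ ν / (p : ℝ) ^ ν by
            rw [← mul_pow, ← div_pow]; norm_num]
          field_simp
          ring
      _ ≤ _ := mul_le_mul_of_nonneg_left h3 (by positivity)
  have hsum : ∑ ν ∈ Finset.range N,
      Lfun (p ^ (ν + 2) * k) η * (rhoPhi F (p ^ (ν + 2)) * u ^ (ν + 2)) ≤
      144 * g / (p : ℝ) ^ 2 * Lfun k η := by
    refine (Finset.sum_le_sum fun ν _ => htail ν).trans ?_
    rw [← Finset.mul_sum]
    calc _ ≤ 72 * g / (p : ℝ) ^ 2 * Lfun k η * 2 :=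
          mul_le_mul_of_nonneg_left (sum_geometric_two_le N) (by positivity)
      _ = _ := by ring
  have hsplit : ∑ ν ∈ Finset.range (N + 2), Lfun (p ^ ν * k) η * (rhoPhi F (p ^ ν) * u ^ ν) =
      ∑ ν ∈ Finset.range N,
        Lfun (p ^ (ν + 2) * k) η * (rhoPhi F (p ^ (ν + 2)) * u ^ (ν + 2)) +
      Lfun (p * k) η * (rhoPhi F p * u) + Lfun k η := by
    rw [Finset.sum_range_succ', Finset.sum_range_succ']
    simp [rhoPhi_one]
  have hmid : Lfun (p * k) η * (rhoPhi F p * u) ≤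
      rhoPhi F p * Lfun (p * k) η + 4 * g * (u - 1) / p * Lfun k η := by
    have h1 : Lfun (p * k) η * rhoPhi F p ≤ 2 * Lfun k η * (2 * g / p) :=
      mul_le_mul hLpk hfp hfp0 (by positivity)
    calc Lfun (p * k) η * (rhoPhi F p * u)
        = rhoPhi F p * Lfun (p * k) η + (u - 1) * (Lfun (p * k) η * rhoPhi F p) := by ring
      _ ≤ rhoPhi F p * Lfun (p * k) η + (u - 1) * (2 * Lfun k η * (2 * g / p)) :=
          add_le_add_right (mul_le_mul_of_nonneg_left h1 (by linarith)) _
      _ = _ := by ring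
  have hε : 0 ≤ 4 * g * (u - 1) / p + 144 * g / (p : ℝ) ^ 2 := by
    have : 0 ≤ u - 1 := by linarith
    positivity
  have hcross : 0 ≤ (4 * g * (u - 1) / p + 144 * g / (p : ℝ) ^ 2) *
      (rhoPhi F p * Lfun (p * k) η) :=
    mul_nonneg hε (mul_nonneg hfp0 (Lfun_nonneg _ _))
  calc _ ≤ ∑ ν ∈ Finset.range (N + 2), Lfun (p ^ ν * k) η * (rhoPhi F (p ^ ν) * u ^ ν) :=
        Finset.sum_le_sum_of_subset_of_nonneg
          (Finset.range_subset_range.2 (by omega)) fun ν _ _ => hnn ν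
    _ ≤ 144 * g / (p : ℝ) ^ 2 * Lfun k η +
          (rhoPhi F p * Lfun (p * k) η + 4 * g * (u - 1) / p * Lfun k η) + Lfun k η := by
        rw [hsplit]
        linarith
    _ ≤ _ := by
        linear_combination hcross

/-- The Rankin weight at the prime `p` for smoothness level `Q`. -/
noncomputable def rankinWeight (Q : ℝ) (p : ℕ) : ℝ :=
  if (p : ℝ) ≤ Q then Real.exp (log p / log Q) else 1

lemma one_le_rankinWeight {Q : ℝ} (hQ : 1 ≤ Q) (p : ℕ) : 1 ≤ rankinWeight Q p := by
  unfold rankinWeight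
  split_ifs
  · exact Real.one_le_exp (div_nonneg (log_natCast_nonneg p) (log_nonneg hQ))
  · exact le_rfl

lemma rankinWeight_sub_one_le {Q : ℝ} {p : ℕ} (hp : 2 ≤ p) :
    rankinWeight Q p - 1 ≤ if (p : ℝ) ≤ Q then 2 * log p / log Q else 0 := by
  unfold rankinWeight
  have hp2 : (2 : ℝ) ≤ p := by exact_mod_cast hp
  split_ifs with h
  · have hQ : 0 < log Q := log_pos (by linarith)
    have h0 : 0 ≤ log p / log Q := div_nonneg (log_natCast_nonneg p) hQ.le
    have h1 : log p / log Q ≤ 1 := (div_le_one hQ).2 (log_le_log (by linarith) h)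
    have := Real.abs_exp_sub_one_le (x := log p / log Q) (by rwa [abs_of_nonneg h0])
    rw [abs_of_nonneg h0] at this
    rw [mul_div_assoc]
    exact (le_abs_self _).trans this
  · simp

lemma rankinWeight_le_three {Q : ℝ} {p : ℕ} (hp : 2 ≤ p) : rankinWeight Q p ≤ 3 := by
  have hp2 : (2 : ℝ) ≤ p := by exact_mod_cast hp
  refine (sub_le_iff_le_add.1 (rankinWeight_sub_one_le (Q := Q) hp)).trans ?_
  split_ifs with h
  · have hQ : 0 < log Q := log_pos (by linarith)
    have : log p / log Q ≤ 1 := (div_le_one hQ).2 (log_le_log (by linarith) h)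
    rw [mul_div_assoc]
    linarith
  · norm_num

lemma sum_rankinWeight_sub_one_div_le (Q : ℝ) (P : Finset ℕ) (hP : ∀ p ∈ P, p.Prime) :
    ∑ p ∈ P, (rankinWeight Q p - 1) / p ≤ 6 := by
  calc ∑ p ∈ P, (rankinWeight Q p - 1) / p
      ≤ ∑ p ∈ P, if (p : ℝ) ≤ Q then 2 / log Q * (log p / p) else 0 := by
        refine Finset.sum_le_sum fun p hp => ?_
        have := div_le_div_of_nonneg_right (rankinWeight_sub_one_le (Q := Q) (hP p hp).two_le)
          (Nat.cast_nonneg (α := ℝ) p)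
        refine this.trans_eq ?_
        split_ifs
        · ring
        · simp
    _ = 2 / log Q * ∑ p ∈ P.filter (fun p : ℕ => (p : ℝ) ≤ Q), log p / p := by
        rw [← Finset.sum_filter, Finset.mul_sum]
    _ ≤ 6 := by
        by_cases hQ : 2 ≤ Q
        · have hlog : 0 < log Q := log_pos (by linarith)
          have hfl : 2 ≤ ⌊Q⌋₊ := Nat.le_floor (by exact_mod_cast hQ)
          have hsub : P.filter (fun p : ℕ => (p : ℝ) ≤ Q) ⊆
              (Finset.range (⌊Q⌋₊ + 1)).filter Nat.Prime := by
            intro p hp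
            rw [Finset.mem_filter] at hp ⊢
            exact ⟨Finset.mem_range.2 (Nat.lt_succ_of_le (Nat.le_floor hp.2)), hP p hp.1⟩
          have h1 : ∑ p ∈ P.filter (fun p : ℕ => (p : ℝ) ≤ Q), log p / p ≤ 3 * log Q := by
            refine (Finset.sum_le_sum_of_subset_of_nonneg hsub fun p _ _ =>
              div_nonneg (log_natCast_nonneg p) (Nat.cast_nonneg p)).trans
              ((sum_primes_log_div_le _ hfl).trans ?_)
            have : log (⌊Q⌋₊ : ℝ) ≤ log Q :=
              log_le_log (by positivity) (Nat.floor_le (by linarith))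
            linarith
          calc _ ≤ 2 / log Q * (3 * log Q) := mul_le_mul_of_nonneg_left h1 (by positivity)
            _ = 6 := by
              field_simp
              norm_num
        · rw [Finset.filter_false_of_mem]
          · simp
          · intro p hp h
            have : (2 : ℝ) ≤ p := by exact_mod_cast (hP p hp).two_le
            exact hQ (this.trans h)

lemma prod_one_add_le (g : ℕ) (Q : ℝ) (P : Finset ℕ) (hP : ∀ p ∈ P, p.Prime) (hQ : 1 ≤ Q) :
    ∏ p ∈ P, (1 + (4 * g * (rankinWeight Q p - 1) / p + 144 * g / (p : ℝ) ^ 2)) ≤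
      Real.exp (24 * g + 144 * g * ∑' n : ℕ, 1 / (n : ℝ) ^ 2) := by
  have hg0 : (0 : ℝ) ≤ g := Nat.cast_nonneg g
  have hsum : ∑ p ∈ P, 1 / (p : ℝ) ^ 2 ≤ ∑' n : ℕ, 1 / (n : ℝ) ^ 2 :=
    (Real.summable_one_div_nat_pow.2 one_lt_two).sum_le_tsum P fun _ _ => by positivity
  calc _ ≤ ∏ p ∈ P, Real.exp (4 * g * (rankinWeight Q p - 1) / p + 144 * g / (p : ℝ) ^ 2) := by
        refine Finset.prod_le_prod (fun p _ => ?_) fun p _ => ?_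
        · have : 0 ≤ rankinWeight Q p - 1 := by linarith [one_le_rankinWeight hQ p]
          positivity
        · rw [add_comm]
          exact Real.add_one_le_exp _
    _ = Real.exp (4 * g * ∑ p ∈ P, (rankinWeight Q p - 1) / p
          + 144 * g * ∑ p ∈ P, 1 / (p : ℝ) ^ 2) := by
        rw [← Real.exp_sum, Finset.sum_add_distrib, Finset.mul_sum, Finset.mul_sum]
        congr 2 <;> exact Finset.sum_congr rfl fun p _ => by ring
    _ ≤ _ := by
        refine Real.exp_le_exp.2 (add_le_add ?_ (mul_le_mul_of_nonneg_left hsum (by positivity)))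
        have := mul_le_mul_of_nonneg_left (sum_rankinWeight_sub_one_div_le Q P hP)
          (show 0 ≤ 4 * (g : ℝ) by positivity)
        linarith

lemma sum_Lfun_rankin_le (F : Polynomial ℤ) (g : ℕ) (η Q : ℝ) (hQ : 1 ≤ Q) (P : Finset ℕ)
    (hP : ∀ p ∈ P, p.Prime) (hP2 : ∀ p ∈ P, 2 * g ≤ p) (hP12 : ∀ p ∈ P, 12 ≤ p)
    (hρ : ∀ p ∈ P, ∀ ν : ℕ, ν ≠ 0 → polyRho F (p ^ ν) ≤ g) (s : Finset ℕ)
    (hs : ∀ l ∈ s, l ≠ 0 ∧ ∀ q : ℕ, q.Prime → q ∣ l → q ∈ P) :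
    ∑ l ∈ s, Lfun l η * (rhoPhi F l * primeWeight (rankinWeight Q) l) ≤
      Real.exp (24 * g + 144 * g * ∑' n : ℕ, 1 / (n : ℝ) ^ 2) *
        ∑ a ∈ P.powerset, (∏ p ∈ a, rhoPhi F p) * Lfun (∏ p ∈ a, p) η := by
  have hlt : ∀ p ∈ P, polyRho F p < p := by
    intro p hp
    have h1 := hρ p hp 1 one_ne_zero
    rw [pow_one] at h1
    have h2 := hP2 p hp
    have h3 := hP12 p hp
    omega
  have hnn (n : ℕ) (hn : ∀ q : ℕ, q.Prime → q ∣ n → q ∈ P) : 0 ≤ rhoPhi F n :=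
    rhoPhi_nonneg F fun q hq hqn => hlt q (hn q hq hqn)
  have hpow (p : ℕ) (hp : p ∈ P) (ν q : ℕ) (hq : q.Prime) (h : q ∣ p ^ ν) : q ∈ P := by
    rwa [(Nat.prime_dvd_prime_iff_eq hq (hP p hp)).1 (hq.dvd_of_dvd_pow h)]
  have hf0 (p : ℕ) (hp : p ∈ P) : 0 ≤ rhoPhi F p :=
    hnn p fun q hq h => hpow p hp 1 q hq (by rwa [pow_one])
  have hu (p : ℕ) : 0 ≤ rankinWeight Q p := zero_le_one.trans (one_le_rankinWeight hQ p)
  have key := sum_le_prod_mul_sum_powerset (fun n => Lfun n η)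
    (fun n => rhoPhi F n * primeWeight (rankinWeight Q) n)
    (fun p => 4 * g * (rankinWeight Q p - 1) / p + 144 * g / (p : ℝ) ^ 2) (rhoPhi F) P hP
    (fun n => Lfun_nonneg n η)
    (fun n hn _ => mul_nonneg (hnn n hn) (primeWeight_nonneg hu n)) hf0
    (fun p _ => by
      have : 0 ≤ rankinWeight Q p - 1 := by linarith [one_le_rankinWeight hQ p]
      positivity)
    (by rw [rhoPhi_one, primeWeight_one, one_mul])
    (fun p hp ν m hm hpm _ => by
      have hpν : p ^ ν ≠ 0 := pow_ne_zero _ (hP p hp).ne_zero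
      have hcop : (p ^ ν).Coprime m := Nat.Coprime.pow_left _ (((hP p hp).coprime_iff_not_dvd).2 hpm)
      rw [rhoPhi_mul F hpν hm hcop, primeWeight_mul _ hpν hm]
      ring)
    (fun p hp k hk N => by
      simp_rw [primeWeight_prime_pow _ (hP p hp)]
      exact sum_Lfun_prime_pow_le F η _ (hP p hp) (hP2 p hp) (hP12 p hp) (hρ p hp)
        (one_le_rankinWeight hQ p) (rankinWeight_le_three (hP p hp).two_le)
        (fun ν => hnn _ (hpow p hp ν)) k hk N)
    P le_rfl 1 one_ne_zero s hs
  simp only [mul_one] at key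
  refine key.trans (mul_le_mul_of_nonneg_right (prod_one_add_le g Q P hP hQ) ?_)
  refine Finset.sum_nonneg fun a ha => mul_nonneg (Finset.prod_nonneg fun p hp => ?_)
    (Lfun_nonneg _ _)
  exact hf0 p (Finset.mem_powerset.1 ha hp)

lemma sq_le_one_add_sum_dyadic {t : ℝ} (ht : 0 ≤ t) {N : ℕ} (hN : t < 2 ^ N) :
    t ^ 2 ≤ 1 + ∑ k ∈ Finset.range N, if (2 : ℝ) ^ k ≤ t then (4 : ℝ) ^ (k + 1) else 0 := by
  have hnn : ∀ k ∈ Finset.range N, 0 ≤ if (2 : ℝ) ^ k ≤ t then (4 : ℝ) ^ (k + 1) else 0 := by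
    intro k _
    split_ifs <;> positivity
  rcases lt_or_ge t 1 with h1 | h1
  · nlinarith [Finset.sum_nonneg hnn]
  · obtain ⟨k, hk1, hk2⟩ := exists_nat_pow_near h1 (one_lt_two (α := ℝ))
    have hkN : k ∈ Finset.range N := by
      rw [Finset.mem_range]
      exact (pow_lt_pow_iff_right₀ (one_lt_two (α := ℝ))).1 (hk1.trans_lt hN)
    have hsingle := Finset.single_le_sum hnn hkN
    rw [if_pos hk1] at hsingle
    have : t ^ 2 ≤ (4 : ℝ) ^ (k + 1) := by
      rw [show (4 : ℝ) = 2 ^ 2 by norm_num, ← pow_mul, mul_comm 2, pow_mul]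
      exact pow_le_pow_left₀ ht hk2.le 2
    linarith

lemma sum_four_pow_mul_exp_le (N : ℕ) :
    ∑ k ∈ Finset.range N, (4 : ℝ) ^ (k + 1) * Real.exp (-(2 ^ k / 2)) ≤ 384 := by
  have hterm (k : ℕ) : (4 : ℝ) ^ (k + 1) * Real.exp (-(2 ^ k / 2)) ≤ 192 * (1 / 2) ^ k := by
    have h := Real.pow_div_factorial_le_exp ((2 : ℝ) ^ k / 2) (by positivity) 3
    have h8 : (8 : ℝ) ^ k = (2 ^ k) ^ 3 := by
      rw [← pow_mul, mul_comm, pow_mul]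
      norm_num
    rw [Real.exp_neg, ← div_eq_mul_inv, div_le_iff₀ (Real.exp_pos _)]
    calc (4 : ℝ) ^ (k + 1) = 192 * (1 / 2) ^ k * (8 ^ k / 48) := by
          rw [show (8 : ℝ) ^ k = 2 ^ k * 4 ^ k by rw [← mul_pow]; norm_num, one_div, inv_pow,
            pow_succ]
          field_simp
          norm_num
      _ ≤ _ := by
          refine mul_le_mul_of_nonneg_left (le_trans (le_of_eq ?_) h) (by positivity)
          rw [h8]
          norm_num [Nat.factorial]
          ring
  refine (Finset.sum_le_sum fun k _ => hterm k).trans ?_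
  rw [← Finset.mul_sum]
  linarith [sum_geometric_two_le N]

lemma hfun_spec {l : ℕ} {X : ℝ} (hl0 : l ≠ 0) (hl : √X < l) :
    (hfun l X).Prime ∧ √X < ∏ p ∈ l.primeFactors.filter (fun p => p ≤ hfun l X),
      (p : ℝ) ^ (l.factorization p) := by
  refine Nat.sInf_mem (s := {q : ℕ | q.Prime ∧
    √X < ∏ p ∈ l.primeFactors.filter (fun p => p ≤ q), (p : ℝ) ^ (l.factorization p)}) ?_
  obtain ⟨q, hlq, hq⟩ := Nat.exists_infinite_primes l
  refine ⟨q, hq, ?_⟩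
  rw [Finset.filter_true_of_mem fun p hp => (Nat.le_of_mem_primeFactors hp).trans hlq]
  have := Nat.prod_factorization_pow_eq_self hl0
  rw [Finsupp.prod, Nat.support_factorization] at this
  have hcast := congrArg (Nat.cast (R := ℝ)) this
  push_cast at hcast
  rwa [hcast]

lemma exp_le_primeWeight_rankin {l h : ℕ} {X Q : ℝ} (hX : 0 < X) (hQ : 1 < Q) (hhQ : (h : ℝ) ≤ Q)
    (hprod : √X < ∏ p ∈ l.primeFactors.filter (fun p => p ≤ h), (p : ℝ) ^ (l.factorization p)) :
    Real.exp (log X / (2 * log Q)) ≤ primeWeight (rankinWeight Q) l := by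
  have hlogQ : 0 < log Q := log_pos hQ
  calc Real.exp (log X / (2 * log Q))
      ≤ Real.exp (log (∏ p ∈ l.primeFactors.filter (fun p => p ≤ h),
          (p : ℝ) ^ (l.factorization p)) / log Q) := by
        refine Real.exp_le_exp.2 ?_
        have := log_le_log (Real.sqrt_pos.2 hX) hprod.le
        rw [log_sqrt hX.le] at this
        rw [← div_div]
        exact div_le_div_of_nonneg_right this hlogQ.le
    _ = ∏ p ∈ l.primeFactors.filter (fun p => p ≤ h), rankinWeight Q p ^ (l.factorization p) := by
        rw [log_prod, Finset.sum_div, Real.exp_sum]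
        · refine Finset.prod_congr rfl fun p hp => ?_
          have hpQ : (p : ℝ) ≤ Q :=
            le_trans (by exact_mod_cast (Finset.mem_filter.1 hp).2) hhQ
          rw [rankinWeight, if_pos hpQ, ← Real.exp_nat_mul, log_pow, mul_div_assoc]
        · intro p hp
          have := (Nat.prime_of_mem_primeFactors (Finset.mem_filter.1 hp).1).pos
          positivity
    _ ≤ primeWeight (rankinWeight Q) l := by
        unfold primeWeight Finsupp.prod
        rw [Nat.support_factorization]
        exact Finset.prod_le_prod_of_subset_of_one_le (Finset.filter_subset _ _)
          (fun p _ => pow_nonneg (zero_le_one.trans (one_le_rankinWeight hQ.le p)) _)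
          fun p _ _ => one_le_pow₀ (one_le_rankinWeight hQ.le p)

lemma one_le_primeWeight {u : ℕ → ℝ} (hu : ∀ p, 1 ≤ u p) (n : ℕ) : 1 ≤ primeWeight u n := by
  unfold primeWeight Finsupp.prod
  exact Finset.one_le_prod fun p _ => one_le_pow₀ (hu p)

lemma inv_log_hfun_sq_le {l N : ℕ} {X : ℝ} (hX : 1 < X) (hl0 : l ≠ 0) (hl : √X < l)
    (hN : log X / log 2 < 2 ^ N) :
    1 / log (hfun l X) ^ 2 ≤ 1 / log X ^ 2 * (primeWeight (rankinWeight X) l +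
      ∑ k ∈ Finset.range N, (4 : ℝ) ^ (k + 1) * Real.exp (-(2 ^ k / 2)) *
        primeWeight (rankinWeight (Real.exp (log X / 2 ^ k))) l) := by
  obtain ⟨hprime, hprod⟩ := hfun_spec hl0 hl
  set h := hfun l X
  have hh2 : (2 : ℝ) ≤ h := by exact_mod_cast hprime.two_le
  have hlogX : 0 < log X := log_pos hX
  have hlogh : 0 < log h := log_pos (by linarith)
  have htN : log X / log h < 2 ^ N :=
    (div_le_div_of_nonneg_left hlogX.le (log_pos one_lt_two)
      (log_le_log two_pos hh2)).trans_lt hN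
  have hone := one_le_primeWeight (fun p => one_le_rankinWeight hX.le p) l
  have hsq := sq_le_one_add_sum_dyadic (div_nonneg hlogX.le hlogh.le) htN
  calc 1 / log h ^ 2 = 1 / log X ^ 2 * (log X / log h) ^ 2 := by
        field_simp
    _ ≤ _ := by
        refine mul_le_mul_of_nonneg_left (hsq.trans (add_le_add hone ?_)) (by positivity)
        refine Finset.sum_le_sum fun k _ => ?_
        have hk : (0 : ℝ) < 2 ^ k := by positivity
        have hQ : 1 < Real.exp (log X / 2 ^ k) := Real.one_lt_exp_iff.2 (by positivity)
        split_ifs with hkt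
        · have hhQ : (h : ℝ) ≤ Real.exp (log X / 2 ^ k) := by
            rw [← log_le_iff_le_exp (by linarith), le_div_iff₀ hk]
            rw [le_div_iff₀ hlogh] at hkt
            linarith
          have := exp_le_primeWeight_rankin (by linarith) hQ hhQ hprod
          rw [Real.log_exp, show log X / (2 * (log X / 2 ^ k)) = 2 ^ k / 2 by field_simp] at this
          calc (4 : ℝ) ^ (k + 1)
              = 4 ^ (k + 1) * Real.exp (-(2 ^ k / 2)) * Real.exp (2 ^ k / 2) := by
                rw [mul_assoc, ← Real.exp_add, neg_add_cancel, Real.exp_zero, mul_one]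
            _ ≤ _ := mul_le_mul_of_nonneg_left this (by positivity)
        · exact mul_nonneg (by positivity)
            (zero_le_one.trans (one_le_primeWeight (fun p => one_le_rankinWeight hQ.le p) l))

lemma sum_Lfun_div_log_hfun_sq_le (F : Polynomial ℤ) (g : ℕ) (η X : ℝ) (hX : 1 < X)
    (P : Finset ℕ) (hP : ∀ p ∈ P, p.Prime) (hP2 : ∀ p ∈ P, 2 * g ≤ p) (hP12 : ∀ p ∈ P, 12 ≤ p)
    (hρ : ∀ p ∈ P, ∀ ν : ℕ, ν ≠ 0 → polyRho F (p ^ ν) ≤ g) (s : Finset ℕ)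
    (hs : ∀ l ∈ s, l ≠ 0 ∧ ∀ q : ℕ, q.Prime → q ∣ l → q ∈ P) (hsX : ∀ l ∈ s, √X < l) :
    ∑ l ∈ s, Lfun l η * rhoPhi F l * (1 / log (hfun l X) ^ 2) ≤
      385 * Real.exp (24 * g + 144 * g * ∑' n : ℕ, 1 / (n : ℝ) ^ 2) / log X ^ 2 *
        ∑ a ∈ P.powerset, (∏ p ∈ a, rhoPhi F p) * Lfun (∏ p ∈ a, p) η := by
  set C := Real.exp (24 * g + 144 * g * ∑' n : ℕ, 1 / (n : ℝ) ^ 2) with hC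
  set S := ∑ a ∈ P.powerset, (∏ p ∈ a, rhoPhi F p) * Lfun (∏ p ∈ a, p) η with hS
  have hlogX : 0 < log X := log_pos hX
  have hlt : ∀ p ∈ P, polyRho F p < p := by
    intro p hp
    have h1 := hρ p hp 1 one_ne_zero
    rw [pow_one] at h1
    have h2 := hP2 p hp
    have h3 := hP12 p hp
    omega
  have hrankin (Q : ℝ) (hQ : 1 ≤ Q) :
      ∑ l ∈ s, Lfun l η * (rhoPhi F l * primeWeight (rankinWeight Q) l) ≤ C * S :=
    sum_Lfun_rankin_le F g η Q hQ P hP hP2 hP12 hρ s hs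
  have hCS : 0 ≤ C * S := by
    have := sum_Lfun_rankin_le F g η X hX.le P hP hP2 hP12 hρ ∅ (by simp)
    rwa [Finset.sum_empty] at this
  obtain ⟨N, hN⟩ := pow_unbounded_of_one_lt (log X / log 2) (one_lt_two (α := ℝ))
  set Q : ℕ → ℝ := fun k => Real.exp (log X / 2 ^ k) with hQdef
  have hQ (k : ℕ) : 1 ≤ Q k := Real.one_le_exp (by positivity)
  calc ∑ l ∈ s, Lfun l η * rhoPhi F l * (1 / log (hfun l X) ^ 2)
      ≤ ∑ l ∈ s, Lfun l η * rhoPhi F l * (1 / log X ^ 2 * (primeWeight (rankinWeight X) l +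
          ∑ k ∈ Finset.range N, (4 : ℝ) ^ (k + 1) * Real.exp (-(2 ^ k / 2)) *
            primeWeight (rankinWeight (Q k)) l)) := by
        refine Finset.sum_le_sum fun l hl => ?_
        refine mul_le_mul_of_nonneg_left
          (inv_log_hfun_sq_le hX (hs l hl).1 (hsX l hl) hN) (mul_nonneg (Lfun_nonneg _ _) ?_)
        exact rhoPhi_nonneg F fun q hq hql => hlt q ((hs l hl).2 q hq hql)
    _ = 1 / log X ^ 2 * (∑ l ∈ s, Lfun l η * (rhoPhi F l * primeWeight (rankinWeight X) l) +
          ∑ k ∈ Finset.range N, (4 : ℝ) ^ (k + 1) * Real.exp (-(2 ^ k / 2)) *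
            ∑ l ∈ s, Lfun l η * (rhoPhi F l * primeWeight (rankinWeight (Q k)) l)) := by
        simp_rw [Finset.mul_sum (s := s)]
        rw [Finset.sum_comm, ← Finset.sum_add_distrib, Finset.mul_sum]
        refine Finset.sum_congr rfl fun l _ => ?_
        rw [mul_left_comm, mul_add, Finset.mul_sum]
        congr 2
        · ring
        · exact Finset.sum_congr rfl fun k _ => by ring
    _ ≤ 1 / log X ^ 2 * (C * S + ∑ k ∈ Finset.range N,
          (4 : ℝ) ^ (k + 1) * Real.exp (-(2 ^ k / 2)) * (C * S)) := by
        refine mul_le_mul_of_nonneg_left (add_le_add (hrankin X hX.le)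
          (Finset.sum_le_sum fun k _ => mul_le_mul_of_nonneg_left (hrankin _ (hQ k)) ?_)) ?_ <;>
        positivity
    _ ≤ 1 / log X ^ 2 * (C * S + 384 * (C * S)) := by
        rw [← Finset.sum_mul]
        have := mul_le_mul_of_nonneg_right (sum_four_pow_mul_exp_le N) hCS
        exact mul_le_mul_of_nonneg_left (by linarith) (by positivity)
    _ = _ := by ring

lemma rhoPhi_prod (F : Polynomial ℤ) (a : Finset ℕ) (ha : ∀ p ∈ a, p.Prime) :
    rhoPhi F (∏ p ∈ a, p) = ∏ p ∈ a, rhoPhi F p := by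
  induction a using Finset.induction_on with
  | empty => simp [rhoPhi_one]
  | insert p a hpa ih =>
    have hp := ha p (Finset.mem_insert_self p a)
    have ha' : ∀ q ∈ a, q.Prime := fun q hq => ha q (Finset.mem_insert_of_mem hq)
    rw [Finset.prod_insert hpa, Finset.prod_insert hpa, rhoPhi_mul F hp.ne_zero
      (Finset.prod_ne_zero_iff.2 fun q hq => (ha' q hq).ne_zero), ih ha']
    refine Nat.Coprime.prod_right fun q hq => (Nat.coprime_primes hp (ha' q hq)).2 ?_
    rintro rfl
    exact hpa hq

lemma Psf_eq_image (s t : ℝ) (ht : 0 ≤ t) :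
    Psf s t = (((Finset.range (⌊t⌋₊ + 1)).filter
      (fun p : ℕ => p.Prime ∧ s < (p : ℝ))).powerset.image (fun a => ∏ p ∈ a, p) : Finset ℕ) := by
  ext n
  simp only [Psf, Set.mem_ofPred_eq, Finset.coe_image, Set.mem_image, Finset.mem_coe,
    Finset.mem_powerset]
  constructor
  · rintro ⟨_, hsq, h⟩
    refine ⟨n.primeFactors, fun p hp => ?_, Nat.prod_primeFactors_of_squarefree hsq⟩
    have hpp := Nat.prime_of_mem_primeFactors hp
    obtain ⟨h1, h2⟩ := h p hpp (Nat.dvd_of_mem_primeFactors hp)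
    exact Finset.mem_filter.2
      ⟨Finset.mem_range.2 (Nat.lt_succ_of_le (Nat.le_floor h2)), hpp, h1⟩
  · rintro ⟨a, ha, rfl⟩
    have hap : ∀ p ∈ a, p.Prime := fun p hp => (Finset.mem_filter.1 (ha hp)).2.1
    refine ⟨Finset.prod_pos fun p hp => (hap p hp).pos, ?_, fun p hp hpa => ?_⟩
    · refine (Finset.squarefree_prod_of_pairwise_isCoprime ?_ fun p hp => (hap p hp).squarefree)
      intro p hp q hq hpq
      exact Nat.coprime_iff_isRelPrime.1 ((Nat.coprime_primes (hap p hp) (hap q hq)).2 hpq)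
    · obtain ⟨q, hq, hpq⟩ := (hp.prime.dvd_finsetProd_iff _).1 hpa
      rw [(Nat.prime_dvd_prime_iff_eq hp (hap q hq)).1 hpq]
      obtain ⟨h1, -, h2⟩ := Finset.mem_filter.1 (ha hq)
      exact ⟨h2, (Nat.le_floor_iff ht).1 (Nat.lt_succ_iff.1 (Finset.mem_range.1 h1))⟩

lemma tsum_Psf_eq (F : Polynomial ℤ) (η s t : ℝ) (ht : 0 ≤ t) :
    ∑' a : (Psf s t), Lfun a η * (polyRho F a : ℝ) / polyPhi F a =
      ∑ a ∈ ((Finset.range (⌊t⌋₊ + 1)).filter (fun p : ℕ => p.Prime ∧ s < (p : ℝ))).powerset,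
        (∏ p ∈ a, rhoPhi F p) * Lfun (∏ p ∈ a, p) η := by
  have hprime : ∀ a ∈ ((Finset.range (⌊t⌋₊ + 1)).filter
      (fun p : ℕ => p.Prime ∧ s < (p : ℝ))).powerset, ∀ p ∈ a, p.Prime := fun a ha p hp =>
    (Finset.mem_filter.1 (Finset.mem_powerset.1 ha hp)).2.1
  rw [Psf_eq_image s t ht]
  refine (Finset.tsum_subtype' _
    (fun a : ℕ => Lfun a η * (polyRho F a : ℝ) / polyPhi F a)).trans ?_
  rw [Finset.sum_image]
  · refine Finset.sum_congr rfl fun a ha => ?_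
    rw [← rhoPhi_prod F a (hprime a ha), rhoPhi]
    ring
  · intro a ha b hb hab
    rw [← Nat.primeFactors_prod (hprime a ha), ← Nat.primeFactors_prod (hprime b hb)]
    exact congrArg _ hab

theorem stmt14 (F : Polynomial ℤ) (hF : Irreducible F) (hdeg : 2 ≤ F.natDegree) :
    ∃ (D : ℕ) (K : ℝ), 2 ≤ D ∧ 0 < K ∧
      (∀ p : ℕ, p.Prime → D < p → polyRho F p < p) ∧
      ∀ η X z : ℝ, 0 < η → 100 ≤ X → X ≤ z →
        ∑' ℓ : {ℓ : ℕ | Real.sqrt X < (ℓ : ℝ) ∧ (∀ p : ℕ, p.Prime → p ∣ ℓ → D < p) ∧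
            (Pplus ℓ : ℝ) ≤ z},
          Lfun ℓ η * (polyRho F ℓ : ℝ) /
            (polyPhi F ℓ * (Real.log (hfun ℓ X)) ^ 2) ≤
        K / (Real.log X) ^ 2 * (Real.log z / Real.log X) ^ (4 * F.natDegree) *
          ∑' a : (Psf D z), Lfun a η * (polyRho F a : ℝ) / polyPhi F a := by
  obtain ⟨R, hR⟩ := exists_prime_bound_eval_derivative F hF (by omega)
  set g := F.natDegree with hg
  set D := R + F.leadingCoeff.natAbs + 2 * g + 12 with hD
  have hρ : ∀ p : ℕ, p.Prime → D < p → ∀ ν : ℕ, ν ≠ 0 → polyRho F (p ^ ν) ≤ g := by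
    intro p hp hDp ν hν
    exact (polyRho_prime_pow_le F p hp (hR p hp (by omega)) ν hν).trans
      (polyRho_le_natDegree F p hp (by omega) hF.ne_zero)
  have hlt : ∀ p : ℕ, p.Prime → D < p → polyRho F p < p := by
    intro p hp hDp
    have := hρ p hp hDp 1 one_ne_zero
    rw [pow_one] at this
    omega
  refine ⟨D, 385 * Real.exp (24 * g + 144 * g * ∑' n : ℕ, 1 / (n : ℝ) ^ 2), by omega,
    by positivity, hlt, fun η X z _ hX hXz => ?_⟩
  have hX1 : 1 < X := by linarith
  have hlogX : 0 < log X := log_pos hX1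
  have hz : 0 ≤ z := by linarith
  rw [tsum_Psf_eq F η D z hz]
  set P := (Finset.range (⌊z⌋₊ + 1)).filter (fun p : ℕ => p.Prime ∧ (D : ℝ) < (p : ℝ)) with hPdef
  set K := 385 * Real.exp (24 * g + 144 * g * ∑' n : ℕ, 1 / (n : ℝ) ^ 2) with hK
  set S := ∑ a ∈ P.powerset, (∏ p ∈ a, rhoPhi F p) * Lfun (∏ p ∈ a, p) η with hS
  have hPmem : ∀ p ∈ P, p.Prime ∧ D < p := fun p hp =>
    ⟨(Finset.mem_filter.1 hp).2.1, by exact_mod_cast (Finset.mem_filter.1 hp).2.2⟩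
  have hfinite (s : Finset ℕ) (hs : ∀ l ∈ s, l ≠ 0 ∧ ∀ q : ℕ, q.Prime → q ∣ l → q ∈ P)
      (hsX : ∀ l ∈ s, √X < l) :
      ∑ l ∈ s, Lfun l η * rhoPhi F l * (1 / log (hfun l X) ^ 2) ≤ K / log X ^ 2 * S :=
    sum_Lfun_div_log_hfun_sq_le F g η X hX1 P (fun p hp => (hPmem p hp).1)
      (fun p hp => by have := (hPmem p hp).2; omega)
      (fun p hp => by have := (hPmem p hp).2; omega)
      (fun p hp => hρ p (hPmem p hp).1 (hPmem p hp).2) s hs hsX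
  have hS0 : 0 ≤ K / log X ^ 2 * S := by
    have := hfinite ∅ (by simp) (by simp)
    rwa [Finset.sum_empty] at this
  have hratio : 1 ≤ (log z / log X) ^ (4 * g) :=
    one_le_pow₀ ((one_le_div hlogX).2 (log_le_log (by linarith) hXz))
  refine le_trans ?_ (show K / log X ^ 2 * S ≤ K / log X ^ 2 * (log z / log X) ^ (4 * g) * S by
    have := mul_le_mul_of_nonneg_right hratio hS0
    linarith)
  refine Real.tsum_le_of_sum_le ?_ ?_
  · intro l
    refine div_nonneg (mul_nonneg (Lfun_nonneg _ _) (Nat.cast_nonneg _))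
      (mul_nonneg (mul_nonneg (Nat.cast_nonneg _) (Finset.prod_nonneg fun p hp => ?_))
        (sq_nonneg _))
    have hpp := Nat.prime_of_mem_primeFactors hp
    have h1 := hlt p hpp (l.2.2.1 p hpp (Nat.dvd_of_mem_primeFactors hp))
    have hp0 : (0 : ℝ) < p := by exact_mod_cast hpp.pos
    rw [sub_nonneg, div_le_one hp0]
    exact_mod_cast h1.le
  · intro u
    have hval : ∀ l ∈ u.map (Function.Embedding.subtype _), √X < ((l : ℕ) : ℝ) ∧
        (∀ p : ℕ, p.Prime → p ∣ l → D < p) ∧ (Pplus l : ℝ) ≤ z := by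
      intro l hl
      obtain ⟨x, _, rfl⟩ := Finset.mem_map.1 hl
      exact x.2
    have hne : ∀ l ∈ u.map (Function.Embedding.subtype _), l ≠ 0 := by
      rintro l hl rfl
      have := (hval 0 hl).1
      rw [Nat.cast_zero] at this
      linarith [Real.sqrt_nonneg X]
    refine le_trans (le_of_eq ?_) (hfinite (u.map (Function.Embedding.subtype _))
      (fun l hl => ⟨hne l hl, fun q hq hql => ?_⟩) fun l hl => (hval l hl).1)
    · rw [Finset.sum_map]
      refine Finset.sum_congr rfl fun l _ => ?_
      rw [Function.Embedding.subtype_apply, rhoPhi, ← div_div]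
      ring
    · obtain ⟨-, h1, h2⟩ := hval l hl
      have hqP : q ≤ Pplus l :=
        Finset.le_sup (f := id) (Nat.mem_primeFactors.2 ⟨hq, hql, hne l hl⟩)
      have hqz : (q : ℝ) ≤ z := le_trans (by exact_mod_cast hqP) h2
      exact Finset.mem_filter.2 ⟨Finset.mem_range.2 (Nat.lt_succ_of_le (Nat.le_floor hqz)), hq,
        by exact_mod_cast h1 q hq hql⟩
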